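/- Coercivity of the least-squares divergence form on curl-free fields: let c ⊂ ℝ² be an open set and C > 0 a constant such that ‖ψ‖_{L²} ≤ C‖∇ψ‖_{L²} for every smooth real-valued ψ with compact support in c. Then every smooth vector field φ : ℝ² → ℝ² with compact support contained in c and ∂₁φ₂ − ∂₂φ₁ = 0 satisfies ∫_{ℝ²} (∂₁φ₁ + ∂₂φ₂)² ≥ (1 + C²)⁻¹ · ( ∫_{ℝ²} (φ₁² + φ₂²) + ∫_{ℝ²} (∂₁φ₁ + ∂₂φ₂)² ), i.e. the bilinear form a(φ, φ) = ‖div φ‖²_{L²} controls the full H(div) norm ‖φ‖²_{L²} + ‖div φ‖²_{L²} with constant (1 + C²)⁻¹. -/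

import Mathlib

open MeasureTheory

/-- For compactly supported `C²` functions `f` and `g`, directional derivatives may be exchanged
inside the integral of their product. -/
theorem integral_fderiv_mul_fderiv_comm {E : Type*} [NormedAddCommGroup E] [NormedSpace ℝ E]
    [FiniteDimensional ℝ E] [MeasurableSpace E] [BorelSpace E] (μ : Measure E)
    [μ.IsAddHaarMeasure] {f g : E → ℝ} (hf : ContDiff ℝ 2 f) (hg : ContDiff ℝ 2 g)
    (hcf : HasCompactSupport f) (v w : E) :
    ∫ x, fderiv ℝ f x v * fderiv ℝ g x w ∂μ = ∫ x, fderiv ℝ f x w * fderiv ℝ g x v ∂μ := by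
  have hdf : ContDiff ℝ 1 (fderiv ℝ f) := hf.fderiv_right (by norm_num)
  have hdg : ContDiff ℝ 1 (fderiv ℝ g) := hg.fderiv_right (by norm_num)
  have hdgw (u : E) : ContDiff ℝ 1 fun x ↦ fderiv ℝ g x u := hdg.clm_apply contDiff_const
  have hcdf (u : E) : HasCompactSupport fun x ↦ fderiv ℝ f x u := hcf.fderiv_apply (𝕜 := ℝ) u
  have hdd (u u' x : E) :
      fderiv ℝ (fun y ↦ fderiv ℝ g y u) x u' = fderiv ℝ (fderiv ℝ g) x u' u := by
    rw [fderiv_clm_apply (hdg.differentiable one_ne_zero x) (differentiableAt_const u)]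
    simp
  have parts (u u' : E) : ∫ x, f x * fderiv ℝ (fderiv ℝ g) x u u' ∂μ
      = -∫ x, fderiv ℝ f x u * fderiv ℝ g x u' ∂μ := by
    simp_rw [← hdd u' u]
    refine integral_mul_fderiv_eq_neg_fderiv_mul_of_integrable ?_ ?_ ?_
      (fun x _ ↦ hf.differentiable two_ne_zero x) (fun x _ ↦ (hdgw u').differentiable one_ne_zero x)
    · exact (((hdf.continuous.clm_apply continuous_const).mul
        (hdgw u').continuous)).integrable_of_hasCompactSupport (hcdf u).mul_right
    · exact (hf.continuous.mul (((hdgw u').continuous_fderiv one_ne_zero).clm_apply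
        continuous_const)).integrable_of_hasCompactSupport hcf.mul_right
    · exact (hf.continuous.mul (hdgw u').continuous).integrable_of_hasCompactSupport hcf.mul_right
  have symm (x : E) : fderiv ℝ (fderiv ℝ g) x v w = fderiv ℝ (fderiv ℝ g) x w v :=
    (hg.contDiffAt.isSymmSndFDerivAt (by simp)).eq v w
  have h := parts v w
  simp_rw [symm, parts w v] at h
  exact (neg_injective h).symm

/-- Coercivity of the least-squares divergence form on curl-free fields: under a
Poincaré inequality on the open set `c`, the form `a(φ, φ) = ‖div φ‖²_{L²}` controls
the full `H(div)` norm `‖φ‖²_{L²} + ‖div φ‖²_{L²}` with constant `(1 + C²)⁻¹`. -/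
theorem div_form_coercive_on_curl_free
    (c : Set (EuclideanSpace ℝ (Fin 2))) (hc : IsOpen c)
    (C : ℝ) (hC : 0 < C)
    (hPoincare : ∀ ψ : EuclideanSpace ℝ (Fin 2) → ℝ,
      ContDiff ℝ (⊤ : ℕ∞) ψ → HasCompactSupport ψ → tsupport ψ ⊆ c →
      Real.sqrt (∫ x : EuclideanSpace ℝ (Fin 2), (ψ x) ^ 2)
        ≤ C * Real.sqrt (∫ x : EuclideanSpace ℝ (Fin 2),
            ((fderiv ℝ ψ x (EuclideanSpace.single 0 1)) ^ 2
              + (fderiv ℝ ψ x (EuclideanSpace.single 1 1)) ^ 2)))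
    (φ₁ φ₂ : EuclideanSpace ℝ (Fin 2) → ℝ)
    (h₁ : ContDiff ℝ (⊤ : ℕ∞) φ₁) (h₂ : ContDiff ℝ (⊤ : ℕ∞) φ₂)
    (hc₁ : HasCompactSupport φ₁) (hc₂ : HasCompactSupport φ₂)
    (hs₁ : tsupport φ₁ ⊆ c) (hs₂ : tsupport φ₂ ⊆ c)
    (hcurl : ∀ x : EuclideanSpace ℝ (Fin 2),
      fderiv ℝ φ₂ x (EuclideanSpace.single 0 1)
        - fderiv ℝ φ₁ x (EuclideanSpace.single 1 1) = 0) :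
    (1 + C ^ 2)⁻¹ *
        ((∫ x : EuclideanSpace ℝ (Fin 2), ((φ₁ x) ^ 2 + (φ₂ x) ^ 2))
          + ∫ x : EuclideanSpace ℝ (Fin 2),
              ((fderiv ℝ φ₁ x (EuclideanSpace.single 0 1))
                + (fderiv ℝ φ₂ x (EuclideanSpace.single 1 1))) ^ 2)
      ≤ ∫ x : EuclideanSpace ℝ (Fin 2),
          ((fderiv ℝ φ₁ x (EuclideanSpace.single 0 1))
            + (fderiv ℝ φ₂ x (EuclideanSpace.single 1 1))) ^ 2 := by
  set e₀ : EuclideanSpace ℝ (Fin 2) := EuclideanSpace.single 0 1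
  set e₁ : EuclideanSpace ℝ (Fin 2) := EuclideanSpace.single 1 1
  have cont {ψ : EuclideanSpace ℝ (Fin 2) → ℝ} (hψ : ContDiff ℝ (⊤ : ℕ∞) ψ)
      (u : EuclideanSpace ℝ (Fin 2)) : Continuous fun x ↦ fderiv ℝ ψ x u :=
    (hψ.continuous_fderiv (by simp)).clm_apply continuous_const
  have int_mul {f g : EuclideanSpace ℝ (Fin 2) → ℝ} (hf : Continuous f) (hg : Continuous g)
      (hcf : HasCompactSupport f) : Integrable fun x ↦ f x * g x :=
    (hf.mul hg).integrable_of_hasCompactSupport hcf.mul_right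
  have int_sq {f : EuclideanSpace ℝ (Fin 2) → ℝ} (hf : Continuous f)
      (hcf : HasCompactSupport f) : Integrable fun x ↦ f x ^ 2 := by
    simpa only [sq] using int_mul hf hf hcf
  have poincare_sq {ψ : EuclideanSpace ℝ (Fin 2) → ℝ} (hψ : ContDiff ℝ (⊤ : ℕ∞) ψ)
      (hcψ : HasCompactSupport ψ) (hsψ : tsupport ψ ⊆ c) :
      ∫ x, ψ x ^ 2 ≤ C ^ 2 * ((∫ x, fderiv ℝ ψ x e₀ ^ 2) + ∫ x, fderiv ℝ ψ x e₁ ^ 2) := by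
    rw [← integral_add (int_sq (cont hψ e₀) (hcψ.fderiv_apply (𝕜 := ℝ) e₀))
      (int_sq (cont hψ e₁) (hcψ.fderiv_apply (𝕜 := ℝ) e₁))]
    have h := pow_le_pow_left₀ (Real.sqrt_nonneg _) (hPoincare ψ hψ hcψ hsψ) 2
    rwa [mul_pow, Real.sq_sqrt (integral_nonneg fun x ↦ by positivity),
      Real.sq_sqrt (integral_nonneg fun x ↦ by positivity)] at h
  have curl (x) : fderiv ℝ φ₂ x e₀ = fderiv ℝ φ₁ x e₁ := sub_eq_zero.mp (hcurl x)
  have hd₁ (u) : HasCompactSupport fun x ↦ fderiv ℝ φ₁ x u := hc₁.fderiv_apply (𝕜 := ℝ) u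
  have hd₂ (u) : HasCompactSupport fun x ↦ fderiv ℝ φ₂ x u := hc₂.fderiv_apply (𝕜 := ℝ) u
  have jacobian : ∫ x, fderiv ℝ φ₁ x e₀ * fderiv ℝ φ₂ x e₁ = ∫ x, fderiv ℝ φ₁ x e₁ ^ 2 := by
    rw [integral_fderiv_mul_fderiv_comm volume (contDiff_infty.mp h₁ 2)
      (contDiff_infty.mp h₂ 2) hc₁]
    simp_rw [curl, sq]
  have div_sq : ∫ x, (fderiv ℝ φ₁ x e₀ + fderiv ℝ φ₂ x e₁) ^ 2
      = (∫ x, fderiv ℝ φ₁ x e₀ ^ 2) + 2 * (∫ x, fderiv ℝ φ₁ x e₁ ^ 2)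
        + ∫ x, fderiv ℝ φ₂ x e₁ ^ 2 := by
    have i₁ := int_sq (cont h₁ e₀) (hd₁ e₀)
    have i₂ := (int_mul (cont h₁ e₀) (cont h₂ e₁) (hd₁ e₀)).const_mul 2
    have i₃ := int_sq (cont h₂ e₁) (hd₂ e₁)
    have i₁₂ : Integrable fun x ↦
        fderiv ℝ φ₁ x e₀ ^ 2 + 2 * (fderiv ℝ φ₁ x e₀ * fderiv ℝ φ₂ x e₁) := i₁.add i₂
    simp_rw [add_sq, mul_assoc]
    rw [integral_add i₁₂ i₃, integral_add i₁ i₂, integral_const_mul, jacobian]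
  have p₁ := poincare_sq h₁ hc₁ hs₁
  have p₂ := poincare_sq h₂ hc₂ hs₂
  simp_rw [curl] at p₂
  rw [inv_mul_le_iff₀ (by positivity),
    integral_add (int_sq h₁.continuous hc₁) (int_sq h₂.continuous hc₂), div_sq]
  linarith
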